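/- arXiv:2506.11816 — 7 statements merged into one kernel-verified Lean document; each statement's English description precedes it below -/
import Mathlib

section
/- Fix ℏ>0, q∈ℝ and points P,r∈ℝ³. Let A:ℝ³→ℝ³ be continuous, χ:ℝ³→ℝ be continuously differentiable, and ρ̃:ℝ³→ℂ be integrable. Set A' := A + ∇χ and ρ̃'(s) := exp(−(q/(iℏ))·(χ(r+s/2) − χ(r−s/2)))·ρ̃(s). Then ∫_{ℝ³} exp((1/(iℏ)) s·(P + (q/2)∫_{−1}^{1} A'(r+τs/2) dτ)) ρ̃'(s) ds = ∫_{ℝ³} exp((1/(iℏ)) s·(P + (q/2)∫_{−1}^{1} A(r+τs/2) dτ)) ρ̃(s) ds. In other words, the Weyl–Stratonovich transform is invariant under gauge transformations. -/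
open MeasureTheory RealInnerProductSpace Complex

section LineIntegralGradient

variable {E : Type*} [NormedAddCommGroup E] [InnerProductSpace ℝ E] [CompleteSpace E]

theorem ContDiff.continuous_gradient {χ : E → ℝ} (hχ : ContDiff ℝ 1 χ) :
    Continuous (gradient χ) :=
  (InnerProductSpace.toDual ℝ E).symm.continuous.comp (hχ.continuous_fderiv one_ne_zero)

/-- The gradient theorem along the segment from `r - s / 2` to `r + s / 2`. -/
theorem inner_intervalIntegral_gradient_segment {χ : E → ℝ} (hχ : ContDiff ℝ 1 χ) (r s : E) :
    ⟪s, ∫ τ in (-1 : ℝ)..1, gradient χ (r + (τ / 2) • s)⟫ =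
      2 * (χ (r + (1 / 2 : ℝ) • s) - χ (r - (1 / 2 : ℝ) • s)) := by
  have hcont : Continuous fun τ : ℝ => gradient χ (r + (τ / 2) • s) :=
    hχ.continuous_gradient.comp (by fun_prop)
  have hderiv (τ : ℝ) : HasDerivAt (fun τ : ℝ => 2 * χ (r + (τ / 2) • s))
      ⟪s, gradient χ (r + (τ / 2) • s)⟫ τ := by
    have hline : HasDerivAt (fun τ : ℝ => r + (τ / 2) • s) ((1 / 2 : ℝ) • s) τ :=
      (((hasDerivAt_id τ).div_const 2).smul_const s).const_add r
    have hgrad := (hχ.differentiable one_ne_zero (r + (τ / 2) • s)).hasGradientAt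
    refine ((hgrad.hasFDerivAt.comp_hasDerivAt τ hline).const_mul 2).congr_deriv ?_
    rw [InnerProductSpace.toDual_apply_apply, real_inner_smul_right, real_inner_comm]
    ring
  have hinner : (∫ τ in (-1 : ℝ)..1, ⟪s, gradient χ (r + (τ / 2) • s)⟫) =
      ⟪s, ∫ τ in (-1 : ℝ)..1, gradient χ (r + (τ / 2) • s)⟫ :=
    (innerSL ℝ s).intervalIntegral_comp_comm (hcont.intervalIntegrable (-1) 1)
  rw [← hinner, intervalIntegral.integral_eq_sub_of_hasDerivAt (fun τ _ => hderiv τ)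
    ((continuous_const.inner hcont).intervalIntegrable _ _), neg_div, neg_smul,
    ← sub_eq_add_neg]
  ring

end LineIntegralGradient

/-- Gauge invariance of the Weyl–Stratonovich transform: replacing the
vector potential `A` by `A + ∇χ` and multiplying the centered density matrix `ρ̃` by the
corresponding phase leaves the transform unchanged. -/
theorem weyl_stratonovich_gauge_invariant
    (ℏ q : ℝ) (hℏ : 0 < ℏ) (P r : EuclideanSpace ℝ (Fin 3))
    (A : EuclideanSpace ℝ (Fin 3) → EuclideanSpace ℝ (Fin 3)) (hA : Continuous A)
    (χ : EuclideanSpace ℝ (Fin 3) → ℝ) (hχ : ContDiff ℝ 1 χ)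
    (ρ : EuclideanSpace ℝ (Fin 3) → ℂ) (hρ : Integrable ρ) :
    (∫ s : EuclideanSpace ℝ (Fin 3),
        Complex.exp ((1 / (Complex.I * ℏ)) *
          (⟪s, P + (q/2) • ∫ τ in (-1:ℝ)..1,
              (A (r + (τ/2) • s) + gradient χ (r + (τ/2) • s))⟫ : ℝ)) *
        (Complex.exp (-(q / (Complex.I * ℏ)) *
            ((χ (r + (1/2:ℝ) • s) - χ (r - (1/2:ℝ) • s) : ℝ) : ℂ)) * ρ s))
      = ∫ s : EuclideanSpace ℝ (Fin 3),
          Complex.exp ((1 / (Complex.I * ℏ)) *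
            (⟪s, P + (q/2) • ∫ τ in (-1:ℝ)..1, A (r + (τ/2) • s)⟫ : ℝ)) * ρ s := by
  have hgrad := hχ.continuous_gradient
  refine integral_congr_ae (.of_forall fun s => ?_)
  have hsplit : (∫ τ in (-1 : ℝ)..1, (A (r + (τ / 2) • s) + gradient χ (r + (τ / 2) • s))) =
      (∫ τ in (-1 : ℝ)..1, A (r + (τ / 2) • s)) +
        ∫ τ in (-1 : ℝ)..1, gradient χ (r + (τ / 2) • s) :=
    intervalIntegral.integral_add
      ((hA.comp (by fun_prop : Continuous fun τ : ℝ => r + (τ / 2) • s)).intervalIntegrable _ _)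
      ((hgrad.comp (by fun_prop : Continuous fun τ : ℝ => r + (τ / 2) • s)).intervalIntegrable
        _ _)
  beta_reduce
  rw [hsplit, smul_add, ← add_assoc, inner_add_right,
    real_inner_smul_right _ (∫ _ in _.._, gradient χ _),
    inner_intervalIntegral_gradient_segment hχ, ← mul_assoc, ← Complex.exp_add]
  congr 2
  push_cast
  ring
end

section
/- Let ℏ>0, q∈ℝ, C:=(2πℏ)^{−3}, and fix r∈ℝ³. Let ψ:ℝ³→ℂ and let A:ℝ³→ℝ³ be continuous. Define ρ̃(s) := ψ(r+s/2)·conj(ψ(r−s/2)), h(s) := exp((q/(2iℏ)) s·∫_{−1}^{1} A(r+τs/2) dτ)·ρ̃(s), and F_s(P) := C ∫_{ℝ³} exp((1/(iℏ)) s·P) h(s) ds. Assume h is continuous and integrable on ℝ³ and that P↦F_s(P) is integrable on ℝ³. Then ∫_{ℝ³} F_s(P) dP = |ψ(r)|². -/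
open MeasureTheory RealInnerProductSpace Complex

open scoped FourierTransform

/-- The Fourier transform with Planck-constant normalization is a rescaling of the standard one. -/
lemma fourier_eq_integral_exp_planck {V : Type*} [NormedAddCommGroup V] [InnerProductSpace ℝ V]
    [MeasurableSpace V] [BorelSpace V] [FiniteDimensional ℝ V] {ℏ : ℝ} (hℏ : ℏ ≠ 0)
    (f : V → ℂ) (w : V) :
    𝓕 f w = ∫ s, Complex.exp ((1 / (Complex.I * ℏ)) *
      (⟪s, (2 * Real.pi * ℏ) • w⟫ : ℝ)) * f s := by
  rw [Real.fourier_eq']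
  refine integral_congr_ae (Filter.Eventually.of_forall fun s => ?_)
  have hℏ' : (ℏ : ℂ) ≠ 0 := by exact_mod_cast hℏ
  simp only [smul_eq_mul, real_inner_smul_right]
  congr 2
  push_cast
  field_simp
  rw [Complex.I_sq]
  ring

/-- The momentum marginal of the Stratonovich function of a pure state `ψ`
is the position probability density `|ψ(r)|²`. -/
theorem stratonovich_momentum_marginal
    (ℏ q : ℝ) (hℏ : 0 < ℏ) (r : EuclideanSpace ℝ (Fin 3))
    (ψ : EuclideanSpace ℝ (Fin 3) → ℂ)
    (A : EuclideanSpace ℝ (Fin 3) → EuclideanSpace ℝ (Fin 3)) (hA : Continuous A)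
    (h : EuclideanSpace ℝ (Fin 3) → ℂ)
    (hdef : ∀ s, h s =
      Complex.exp ((q / (2 * Complex.I * ℏ)) *
          (⟪s, ∫ τ in (-1:ℝ)..1, A (r + (τ/2) • s)⟫ : ℝ)) *
        (ψ (r + (1/2 : ℝ) • s) * starRingEnd ℂ (ψ (r - (1/2 : ℝ) • s))))
    (hcont : Continuous h) (hint : Integrable h)
    (Fs : EuclideanSpace ℝ (Fin 3) → ℂ)
    (hFs : ∀ P, Fs P = (((2 * Real.pi * ℏ) ^ 3)⁻¹ : ℝ) *
      ∫ s, Complex.exp ((1 / (Complex.I * ℏ)) * (⟪s, P⟫ : ℝ)) * h s)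
    (hFint : Integrable Fs) :
    ∫ P, Fs P = ψ r * starRingEnd ℂ (ψ r) := by
  have ha : (0 : ℝ) < 2 * Real.pi * ℏ := by positivity
  have hfin : Module.finrank ℝ (EuclideanSpace ℝ (Fin 3)) = 3 := by simp
  have ha' : (((2 * Real.pi * ℏ) ^ 3 : ℝ) : ℂ) ≠ 0 := by exact_mod_cast (pow_pos ha 3).ne'
  have hF : 𝓕 h = fun w => (((2 * Real.pi * ℏ) ^ 3 : ℝ) : ℂ) * Fs ((2 * Real.pi * ℏ) • w) := by
    funext w
    rw [hFs, Complex.ofReal_inv, mul_inv_cancel_left₀ ha', fourier_eq_integral_exp_planck hℏ.ne']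
  have hFint' : Integrable (𝓕 h) := by
    rw [hF]
    exact (hFint.comp_smul ha.ne').const_mul _
  have hInv : ∫ w, 𝓕 h w = h 0 := by
    rw [← hint.fourierInv_fourier_eq hFint' hcont.continuousAt, Real.fourierInv_eq']
    simp
  have hscale : ∫ w, 𝓕 h w = ∫ P, Fs P := by
    rw [hF, integral_const_mul, Measure.integral_comp_smul_of_nonneg volume Fs _ (hR := ha.le),
      hfin, Complex.real_smul, Complex.ofReal_inv, mul_inv_cancel_left₀ ha']
  rw [← hscale, hInv, hdef]
  simp
end

section
/- Let ℏ>0, q∈ℝ, m>0, C:=(2πℏ)^{−3}, and fix r∈ℝ³. Let ψ:ℝ³→ℂ be continuous and differentiable at r, and let A:ℝ³→ℝ³ be continuous. Define ρ̃(s) := ψ(r+s/2)·conj(ψ(r−s/2)), h(s) := exp((q/(2iℏ)) s·∫_{−1}^{1} A(r+τs/2) dτ)·ρ̃(s), and F_s(P) := C ∫_{ℝ³} exp((1/(iℏ)) s·P) h(s) ds. Assume h is continuous and integrable, P↦F_s(P) is integrable, and P↦|P|·|F_s(P)| is integrable. Then (1/m)∫_{ℝ³} P·F_s(P) dP = −(iℏ/(2m))·(conj(ψ(r))∇ψ(r)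 − ψ(r)∇conj(ψ)(r)) − (q/m)|ψ(r)|² A(r), i.e. the first momentum moment of the Stratonovich function equals the gauge-invariant probability current j(r). -/
open MeasureTheory RealInnerProductSpace Complex

open FourierTransform in
/-- The directional derivative at the origin of a function whose Fourier transform has an
integrable first moment, expressed through Fourier inversion. -/
theorem hasDerivAt_smul_zero_of_integrable_norm_mul_fourier
    {V : Type*} [NormedAddCommGroup V] [InnerProductSpace ℝ V] [FiniteDimensional ℝ V]
    [MeasurableSpace V] [BorelSpace V] {f : V → ℂ} (hc : Continuous f) (hf : Integrable f)
    (hFf : Integrable (𝓕 f)) (hm : Integrable (fun w : V => ‖w‖ * ‖𝓕 f w‖)) (e : V) :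
    HasDerivAt (fun t : ℝ => f (t • e)) (2 * Real.pi * I * ∫ w, (⟪w, e⟫ : ℝ) * 𝓕 f w) 0 := by
  have hinv : ∀ t : ℝ, f (t • e) = 𝓕 (𝓕 f) (t • (-e)) := fun t => by
    rw [smul_neg, ← Real.fourierInv_eq_fourier_neg, hc.fourierInv_fourier_eq hf hFf]
  have hg : Integrable (VectorFourier.fourierSMulRight (innerSL ℝ) (𝓕 f)) := by
    refine Integrable.mono' (hm.const_mul (2 * Real.pi * ‖innerSL ℝ (E := V)‖))
      (hFf.aestronglyMeasurable.fourierSMulRight) (.of_forall fun v => ?_)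
    refine (VectorFourier.norm_fourierSMulRight_le _ _ _).trans_eq ?_
    ring
  have hl : HasDerivAt (fun t : ℝ => t • (-e)) (-e) 0 := by
    simpa using (hasDerivAt_id (0 : ℝ)).smul_const (-e)
  have hd := (Real.hasFDerivAt_fourier hFf hm ((0 : ℝ) • (-e))).comp_hasDerivAt (0 : ℝ) hl
  simp_rw [hinv]
  refine hd.congr_deriv ?_
  rw [Real.fourier_eq]
  simp only [zero_smul, inner_zero_right, neg_zero, AddChar.map_zero_eq_one, one_smul]
  rw [ContinuousLinearMap.integral_apply hg, ← integral_const_mul]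
  refine integral_congr_ae (.of_forall fun v => ?_)
  have hv : VectorFourier.fourierSMulRight (innerSL ℝ) (𝓕 f) v (-e)
      = -(2 * Real.pi * I) * ((-⟪v, e⟫ : ℝ) * 𝓕 f v) := by
    rw [← inner_neg_right]
    rfl
  simp only [hv, ofReal_neg]
  ring

/-- If `g` is continuous at `0`, then `t ↦ t * g t` has derivative `g 0` at `0`. -/
theorem hasDerivAt_mul_zero_of_continuousAt {g : ℝ → ℝ} (hg : ContinuousAt g 0) :
    HasDerivAt (fun t => t * g t) (g 0) 0 := by
  rw [hasDerivAt_iff_tendsto_slope]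
  refine (hg.tendsto.mono_left nhdsWithin_le_nhds).congr' ?_
  filter_upwards [self_mem_nhdsWithin] with t ht
  have : t ≠ 0 := ht
  simp [slope_def_field, this]

/-- The derivative at `0`, along `e`, of the gauge phase exponent `s · ∫ A(r + τs/2) dτ`. -/
theorem hasDerivAt_inner_integral_line {V : Type*} [NormedAddCommGroup V] [InnerProductSpace ℝ V]
    [CompleteSpace V] {A : V → V} (hA : Continuous A) (r e : V) :
    HasDerivAt (fun t : ℝ => ⟪t • e, ∫ τ in (-1:ℝ)..1, A (r + (τ/2) • (t • e))⟫)
      (2 * ⟪e, A r⟫) 0 := by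
  have hc : Continuous fun t : ℝ => ⟪e, ∫ τ in (-1:ℝ)..1, A (r + (τ/2) • (t • e))⟫ := by
    refine continuous_const.inner ?_
    apply intervalIntegral.continuous_parametric_intervalIntegral_of_continuous'
    unfold Function.uncurry
    fun_prop
  have hd := hasDerivAt_mul_zero_of_continuousAt hc.continuousAt
  simp_rw [real_inner_smul_left]
  refine hd.congr_deriv ?_
  simp [real_inner_smul_right]
  norm_num

/-- The derivative at `0`, along `e`, of the centered density matrix of a pure state. -/
theorem hasDerivAt_centered_density {V : Type*} [NormedAddCommGroup V] [NormedSpace ℝ V]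
    {ψ : V → ℂ} {r : V} (hψ : DifferentiableAt ℝ ψ r) (e : V) :
    HasDerivAt
      (fun t : ℝ => ψ (r + (1/2 : ℝ) • (t • e)) * starRingEnd ℂ (ψ (r - (1/2 : ℝ) • (t • e))))
      (1 / 2 * (starRingEnd ℂ (ψ r) * fderiv ℝ ψ r e
        - ψ r * fderiv ℝ (fun x => starRingEnd ℂ (ψ x)) r e)) 0 := by
  have hψs : DifferentiableAt ℝ (fun x => starRingEnd ℂ (ψ x)) r := hψ.star
  have hl : HasDerivAt (fun t : ℝ => (1/2 : ℝ) • (t • e)) ((1/2 : ℝ) • e) 0 := by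
    simpa using ((hasDerivAt_id (0 : ℝ)).smul_const e).fun_const_smul (1/2 : ℝ)
  have h₁ : HasDerivAt (fun t : ℝ => ψ (r + (1/2 : ℝ) • (t • e)))
      (fderiv ℝ ψ r ((1/2 : ℝ) • e)) 0 :=
    HasFDerivAt.comp_hasDerivAt (0 : ℝ) (by simpa using hψ.hasFDerivAt) (hl.const_add r)
  have h₂ : HasDerivAt (fun t : ℝ => starRingEnd ℂ (ψ (r - (1/2 : ℝ) • (t • e))))
      (fderiv ℝ (fun x => starRingEnd ℂ (ψ x)) r (-((1/2 : ℝ) • e))) 0 :=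
    HasFDerivAt.comp_hasDerivAt (0 : ℝ) (l := fun x => starRingEnd ℂ (ψ x))
      (by simpa using hψs.hasFDerivAt) (hl.const_sub r)
  refine (h₁.mul h₂).congr_deriv ?_
  simp only [zero_smul, smul_zero, add_zero, sub_zero, map_neg, map_smul, real_smul]
  push_cast
  ring

/-- The first momentum moment of the Stratonovich function of a pure state
`ψ` equals the gauge-invariant probability current
`j(r) = −(iℏ/(2m))(ψ*∇ψ − ψ∇ψ*) − (q/m)|ψ|²A(r)` (componentwise). -/
theorem stratonovich_first_moment_is_current
    (ℏ q m : ℝ) (hℏ : 0 < ℏ) (hm : 0 < m) (r : EuclideanSpace ℝ (Fin 3))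
    (ψ : EuclideanSpace ℝ (Fin 3) → ℂ) (hψc : Continuous ψ)
    (hψd : DifferentiableAt ℝ ψ r)
    (A : EuclideanSpace ℝ (Fin 3) → EuclideanSpace ℝ (Fin 3)) (hA : Continuous A)
    (h : EuclideanSpace ℝ (Fin 3) → ℂ)
    (hdef : ∀ s, h s =
      Complex.exp ((q / (2 * Complex.I * ℏ)) *
          (⟪s, ∫ τ in (-1:ℝ)..1, A (r + (τ/2) • s)⟫ : ℝ)) *
        (ψ (r + (1/2 : ℝ) • s) * starRingEnd ℂ (ψ (r - (1/2 : ℝ) • s))))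
    (hcont : Continuous h) (hint : Integrable h)
    (Fs : EuclideanSpace ℝ (Fin 3) → ℂ)
    (hFs : ∀ P, Fs P = (((2 * Real.pi * ℏ) ^ 3)⁻¹ : ℝ) *
      ∫ s, Complex.exp ((1 / (Complex.I * ℏ)) * (⟪s, P⟫ : ℝ)) * h s)
    (hFint : Integrable Fs)
    (hFmom : Integrable (fun P : EuclideanSpace ℝ (Fin 3) => ‖P‖ * ‖Fs P‖)) :
    ∀ j : Fin 3,
      (1 / (m : ℂ)) * ∫ P : EuclideanSpace ℝ (Fin 3), (P j : ℂ) * Fs P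
        = -(Complex.I * ℏ / (2 * m)) *
            (starRingEnd ℂ (ψ r) * fderiv ℝ ψ r (EuclideanSpace.single j 1)
              - ψ r * fderiv ℝ (fun x => starRingEnd ℂ (ψ x)) r (EuclideanSpace.single j 1))
          - (q / m : ℝ) * (ψ r * starRingEnd ℂ (ψ r)) * (A r j : ℝ) := by
  intro j
  set e : EuclideanSpace ℝ (Fin 3) := EuclideanSpace.single j 1 with he
  have hie : ∀ x : EuclideanSpace ℝ (Fin 3), ⟪x, e⟫ = x j := fun x => by
    simp [he, EuclideanSpace.inner_single_right]
  set κ : ℝ := (2 * Real.pi * ℏ)⁻¹ with hκ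
  have hκ0 : 0 < κ := by positivity
  have hℏc : (ℏ : ℂ) ≠ 0 := by exact_mod_cast hℏ.ne'
  have hmc : (m : ℂ) ≠ 0 := by exact_mod_cast hm.ne'
  have hπc : (Real.pi : ℂ) ≠ 0 := by exact_mod_cast Real.pi_ne_zero
  have hF : ∀ P, Fs P = (κ ^ 3 : ℝ) * FourierTransform.fourier h (κ • P) := fun P => by
    rw [hFs, Real.fourier_eq', hκ, inv_pow]
    congr 1
    refine integral_congr_ae (.of_forall fun s => ?_)
    simp only [smul_eq_mul, real_inner_smul_right]
    congr 2
    push_cast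
    field_simp
    simp
  have hFh : ∀ P, FourierTransform.fourier h (κ • P) = ((κ ^ 3)⁻¹ : ℝ) * Fs P := fun P => by
    rw [hF, ← mul_assoc, ← ofReal_mul, inv_mul_cancel₀ (by positivity), ofReal_one, one_mul]
  have hFh_int : Integrable (FourierTransform.fourier h) := by
    rw [← integrable_comp_smul_iff volume _ hκ0.ne']
    simp_rw [hFh]
    exact hFint.const_mul _
  have hFh_mom : Integrable (fun Q => ‖Q‖ * ‖FourierTransform.fourier h Q‖) := by
    rw [← integrable_comp_smul_iff volume _ hκ0.ne']
    refine (hFmom.const_mul (κ * (κ ^ 3)⁻¹)).congr (.of_forall fun P => ?_)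
    simp only [hFh, norm_smul, norm_mul, norm_real, Real.norm_eq_abs]
    rw [abs_of_pos hκ0, abs_of_pos (by positivity : 0 < (κ ^ 3)⁻¹)]
    ring
  have hmoment : ∫ P : EuclideanSpace ℝ (Fin 3), (P j : ℂ) * Fs P
      = (κ⁻¹ : ℝ) * ∫ Q : EuclideanSpace ℝ (Fin 3), (⟪Q, e⟫ : ℝ) * FourierTransform.fourier h Q := by
    have hs := Measure.integral_comp_smul volume
      (fun Q : EuclideanSpace ℝ (Fin 3) => (⟪Q, e⟫ : ℝ) * FourierTransform.fourier h Q) κ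
    rw [finrank_euclideanSpace_fin, abs_of_pos (by positivity), real_smul] at hs
    have hP : ∀ P : EuclideanSpace ℝ (Fin 3), (P j : ℂ) * Fs P
        = (κ ^ 2 : ℝ) * ((⟪κ • P, e⟫ : ℝ) * FourierTransform.fourier h (κ • P)) := fun P => by
      rw [hF, real_inner_smul_left, hie]
      push_cast
      ring
    simp_rw [hP]
    rw [integral_const_mul, hs, ← mul_assoc, ← ofReal_mul]
    congr 2
    field_simp
  have hd₁ := hasDerivAt_smul_zero_of_integrable_norm_mul_fourier hcont hint hFh_int hFh_mom e
  have hd₂ := ((((hasDerivAt_inner_integral_line hA r e).ofReal_comp).const_mul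
    ((q : ℂ) / (2 * I * ℏ))).cexp).mul (hasDerivAt_centered_density hψd e)
  have hd := hd₁.unique (hd₂.congr_of_eventuallyEq (.of_forall fun t => hdef _))
  simp only [zero_smul, inner_zero_left, smul_zero, add_zero, sub_zero, ofReal_zero, mul_zero,
    Complex.exp_zero, one_mul, real_inner_comm (A r) e, hie] at hd
  rw [hmoment, hκ, inv_inv]
  have hI : 1 / (m : ℂ) * ((2 * Real.pi * ℏ : ℝ) * ∫ Q, ((⟪Q, e⟫ : ℝ) : ℂ) * FourierTransform.fourier h Q)
      = -(I * ℏ / m) * (2 * Real.pi * I * ∫ Q, ((⟪Q, e⟫ : ℝ) : ℂ) * FourierTransform.fourier h Q) := by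
    push_cast
    linear_combination (2 * Real.pi * ℏ / m * ∫ Q, ((⟪Q, e⟫ : ℝ) : ℂ) * FourierTransform.fourier h Q) * I_sq
  rw [hI]
  simp_rw [hie]
  rw [hd]
  push_cast
  field_simp
  ring
end

section
/- Let A:ℝ³→ℝ³ be continuous and fix r∈ℝ³. Define G:ℝ³→ℝ by G(s) := (1/2) s·∫_{−1}^{1} A(r+τs/2) dτ. Then G is (Fréchet) differentiable at s=0 and ∇G(0) = A(r). -/
open MeasureTheory RealInnerProductSpace

/-- If `F` is continuous at `0`, then `s ↦ ⟪s, F s⟫` has gradient `F 0` at `0`. -/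
theorem hasGradientAt_inner_self_apply_zero {E : Type*} [NormedAddCommGroup E]
    [InnerProductSpace ℝ E] [CompleteSpace E] {F : E → E} (hF : ContinuousAt F 0) :
    HasGradientAt (fun s => ⟪s, F s⟫) (F 0) 0 := by
  rw [hasGradientAt_iff_isLittleO, Asymptotics.isLittleO_iff]
  intro c hc
  filter_upwards [Metric.continuousAt_iff'.1 hF c hc] with s hs
  have h : ⟪s, F s⟫ - ⟪(0 : E), F 0⟫ - ⟪F 0, s - 0⟫ = ⟪s, F s - F 0⟫ := by
    rw [inner_zero_left, sub_zero, sub_zero, inner_sub_right, real_inner_comm s (F 0)]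
  rw [h, sub_zero, mul_comm]
  rw [dist_eq_norm] at hs
  exact (norm_inner_le_norm s _).trans (by gcongr)

/-- For continuous `A : ℝ³ → ℝ³` and fixed `r`, the function
`G(s) = (1/2) s·∫_{−1}^{1} A(r+τs/2) dτ` is differentiable at `s = 0` with gradient `A(r)`. -/
theorem line_integral_gradient_at_zero
    (A : EuclideanSpace ℝ (Fin 3) → EuclideanSpace ℝ (Fin 3)) (hA : Continuous A)
    (r : EuclideanSpace ℝ (Fin 3)) :
    HasGradientAt
      (fun s : EuclideanSpace ℝ (Fin 3) =>
        (1/2 : ℝ) * ⟪s, ∫ τ in (-1:ℝ)..1, A (r + (τ/2) • s)⟫)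
      (A r) (0 : EuclideanSpace ℝ (Fin 3)) := by
  have hA' : Continuous (Function.uncurry fun (s : EuclideanSpace ℝ (Fin 3)) (τ : ℝ) =>
      A (r + (τ/2) • s)) := by
    unfold Function.uncurry
    fun_prop
  have hF : Continuous fun s : EuclideanSpace ℝ (Fin 3) =>
      (1/2 : ℝ) • ∫ τ in (-1:ℝ)..1, A (r + (τ/2) • s) :=
    (intervalIntegral.continuous_parametric_intervalIntegral_of_continuous'
      (μ := volume) hA' (-1) 1).const_smul (1/2 : ℝ)
  have h0 : (1/2 : ℝ) • ∫ τ in (-1:ℝ)..1, A (r + (τ/2) • (0 : EuclideanSpace ℝ (Fin 3))) = A r := by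
    simp only [smul_zero, add_zero, intervalIntegral.integral_const, smul_smul]
    norm_num
  have h := hasGradientAt_inner_self_apply_zero hF.continuousAt
  simp only [h0, real_inner_smul_right] at h
  exact h
end

section
/- Let ℏ>0, q∈ℝ, C:=(2πℏ)^{−3}, fix P,r∈ℝ³, let I⊆ℝ be an open interval, and let α₀∈I. Let A:ℝ³×I→ℝ³ be continuous with α↦A(x,α) differentiable with continuous derivative ∂_αA, and let ρ̃:ℝ³×I→ℂ be such that ρ̃(·,α) is integrable for each α and α↦ρ̃(s,α) is differentiable. Assume there exist integrable G₁,G₂:ℝ³→[0,∞) such that for all α in a neighborhood of α₀, all s∈ℝ³ and all τ∈[−1,1]: |∂_αρ̃(s,α)| ≤ G₁(s) and |s|·|∂_αA(r+τs/2,α)|·|ρ̃(s,α)| ≤ G₂(s). Define F_s(P,r,α) := C∫_{ℝ³} exp(Φ(s,α)) ρ̃(s,α) ds with Φ(s,α) := (1/(iℏ)) s·(P + (q/2)∫_{−1}^{1} A(r+τs/2,α) dτ). Then α↦F_s(P,r,α) is differentiable at α₀ and ∂_αF_s(P,r,α₀) = C∫_{ℝ³} exp(Φ(s,α₀)) ∂_αρ̃(s,α₀)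 ds + (q/(2iℏ)) C∫_{ℝ³} exp(Φ(s,α₀)) (s·∫_{−1}^{1} ∂_αA(r+τs/2,α₀) dτ) ρ̃(s,α₀) ds. -/
open MeasureTheory RealInnerProductSpace Complex

/-- The exponent of the Weyl–Stratonovich transform with a parameter `α`. -/
noncomputable def wsPhase (ℏ q : ℝ) (P r : EuclideanSpace ℝ (Fin 3))
    (A : EuclideanSpace ℝ (Fin 3) → ℝ → EuclideanSpace ℝ (Fin 3))
    (s : EuclideanSpace ℝ (Fin 3)) (α : ℝ) : ℂ :=
  (1 / (Complex.I * ℏ)) *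
    (⟪s, P + (q/2) • ∫ τ in (-1:ℝ)..1, A (r + (τ/2) • s) α⟫ : ℝ)

open scoped Topology
open Filter

/-- Leibniz rule over a compact interval, for a continuous parameter derivative. -/
lemma hasDerivAt_intervalIntegral_of_continuousOn {E : Type*} [NormedAddCommGroup E]
    [NormedSpace ℝ E] {f f' : ℝ → ℝ → E} {U : Set ℝ} (hU : IsOpen U) {c d x₀ : ℝ}
    (hx₀ : x₀ ∈ U) (hf : ∀ x ∈ U, Continuous (f x))
    (hf' : ContinuousOn (Function.uncurry f') (U ×ˢ Set.univ))
    (hd : ∀ x ∈ U, ∀ t, HasDerivAt (fun y => f y t) (f' x t) x) :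
    HasDerivAt (fun x => ∫ t in c..d, f x t) (∫ t in c..d, f' x₀ t) x₀ := by
  obtain ⟨δ, hδ, hδU⟩ := Metric.nhds_basis_closedBall.mem_iff.1 (hU.mem_nhds hx₀)
  obtain ⟨M, hM⟩ := ((isCompact_closedBall x₀ δ).prod
    (isCompact_uIcc (a := c) (b := d))).exists_bound_of_continuousOn
    (hf'.mono (Set.prod_mono hδU (Set.subset_univ _)))
  have hc : Continuous (f' x₀) :=
    hf'.comp_continuous (Continuous.prodMk_right x₀) fun t => ⟨hx₀, Set.mem_univ t⟩
  refine (intervalIntegral.hasDerivAt_integral_of_dominated_loc_of_deriv_le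
    (bound := fun _ => M) (Metric.closedBall_mem_nhds x₀ hδ) ?_
    ((hf x₀ hx₀).intervalIntegrable c d) hc.aestronglyMeasurable ?_
    intervalIntegrable_const ?_).2
  · filter_upwards [hU.mem_nhds hx₀] with x hx using (hf x hx).aestronglyMeasurable
  · exact ae_of_all _ fun t ht x hx => hM (x, t) ⟨hx, Set.uIoc_subset_uIcc ht⟩
  · exact ae_of_all _ fun t _ x hx => hd x (hδU hx) t

/-- A pointwise derivative of a family of a.e. strongly measurable functions is a.e. strongly
measurable. -/
lemma aestronglyMeasurable_of_hasDerivAt_param {X E : Type*} [MeasurableSpace X]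
    {μ : Measure X} [NormedAddCommGroup E] [NormedSpace ℝ E] {f : X → ℝ → E} {f' : X → E}
    {x₀ : ℝ} (hf : ∀ᶠ x in 𝓝 x₀, AEStronglyMeasurable (fun s => f s x) μ)
    (hd : ∀ s, HasDerivAt (f s) (f' s) x₀) : AEStronglyMeasurable f' μ := by
  obtain ⟨u, hu⟩ := exists_seq_tendsto (𝓝[≠] x₀)
  obtain ⟨N, hN⟩ := eventually_atTop.1 (hu.eventually (hf.filter_mono nhdsWithin_le_nhds))
  refine aestronglyMeasurable_of_tendsto_ae (u := atTop)
    (f := fun n s => slope (f s) x₀ (u (n + N))) (fun n => ?_) (ae_of_all _ fun s => ?_)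
  · simp only [slope_def_module]
    exact ((hN (n + N) (Nat.le_add_left N n)).sub hf.self_of_nhds).const_smul _
  · exact (hd s).tendsto_slope.comp (hu.comp (tendsto_add_atTop_nat N))

lemma norm_exp_wsPhase (ℏ q : ℝ) (P r : EuclideanSpace ℝ (Fin 3))
    (A : EuclideanSpace ℝ (Fin 3) → ℝ → EuclideanSpace ℝ (Fin 3))
    (s : EuclideanSpace ℝ (Fin 3)) (α : ℝ) : ‖Complex.exp (wsPhase ℏ q P r A s α)‖ = 1 := by
  rw [Complex.norm_exp, wsPhase, Complex.re_mul_ofReal]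
  simp

lemma continuous_intervalIntegral_segment {B : EuclideanSpace ℝ (Fin 3) → EuclideanSpace ℝ (Fin 3)}
    (hB : Continuous B) (r : EuclideanSpace ℝ (Fin 3)) (c d : ℝ) :
    Continuous fun s => ∫ τ in c..d, B (r + (τ / 2) • s) :=
  intervalIntegral.continuous_parametric_intervalIntegral_of_continuous' (by
    unfold Function.uncurry
    fun_prop) c d

lemma hasDerivAt_wsPhase {U : Set ℝ} (hU : IsOpen U)
    {A A' : EuclideanSpace ℝ (Fin 3) → ℝ → EuclideanSpace ℝ (Fin 3)}
    (hAc : ∀ α ∈ U, Continuous fun x => A x α)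
    (hA' : ∀ x, ∀ α ∈ U, HasDerivAt (A x) (A' x α) α)
    (hA'c : ContinuousOn (Function.uncurry A') (Set.univ ×ˢ U))
    (ℏ q : ℝ) (P r s : EuclideanSpace ℝ (Fin 3)) {α : ℝ} (hα : α ∈ U) :
    HasDerivAt (wsPhase ℏ q P r A s)
      ((q / (2 * Complex.I * ℏ)) *
        (⟪s, ∫ τ in (-1:ℝ)..1, A' (r + (τ/2) • s) α⟫ : ℝ)) α := by
  have h : HasDerivAt (fun α => ∫ τ in (-1:ℝ)..1, A (r + (τ/2) • s) α)
      (∫ τ in (-1:ℝ)..1, A' (r + (τ/2) • s) α) α := by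
    refine hasDerivAt_intervalIntegral_of_continuousOn
      (f := fun α τ => A (r + (τ/2) • s) α) (f' := fun α τ => A' (r + (τ/2) • s) α) hU hα
      (fun x hx => (hAc x hx).comp (by fun_prop)) ?_ (fun x hx t => hA' _ x hx)
    exact hA'c.comp (f := fun p : ℝ × ℝ => (r + (p.2/2) • s, p.1))
      (by fun_prop) fun p hp => ⟨Set.mem_univ _, hp.1⟩
  have h2 := (((hasDerivAt_const α s).inner ℝ ((h.const_smul (q/2)).const_add P)).ofReal_comp
    ).const_mul (1 / (Complex.I * ℏ))
  refine h2.congr_deriv ?_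
  simp only [inner_zero_left, add_zero, inner_smul_right]
  push_cast
  simp only [div_eq_mul_inv, mul_inv]
  ring

/-- Differentiating the Weyl–Stratonovich transform with respect to a
parameter `α` (time or a space coordinate) yields the transform of `∂_α ρ̃` plus a term
containing `∂_α A`. -/
theorem stratonovich_parameter_derivative
    (ℏ q : ℝ) (hℏ : 0 < ℏ) (P r : EuclideanSpace ℝ (Fin 3))
    (a b : ℝ) (α₀ : ℝ) (hα₀ : α₀ ∈ Set.Ioo a b)
    (A A' : EuclideanSpace ℝ (Fin 3) → ℝ → EuclideanSpace ℝ (Fin 3))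
    (hAc : ContinuousOn (Function.uncurry A) (Set.univ ×ˢ Set.Ioo a b))
    (hA' : ∀ x : EuclideanSpace ℝ (Fin 3), ∀ α ∈ Set.Ioo a b, HasDerivAt (A x) (A' x α) α)
    (hA'c : ContinuousOn (Function.uncurry A') (Set.univ ×ˢ Set.Ioo a b))
    (ρ ρ' : EuclideanSpace ℝ (Fin 3) → ℝ → ℂ)
    (hρi : ∀ α ∈ Set.Ioo a b, Integrable (fun s => ρ s α))
    (hρ' : ∀ s : EuclideanSpace ℝ (Fin 3), ∀ α ∈ Set.Ioo a b, HasDerivAt (ρ s) (ρ' s α) α)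
    (G₁ G₂ : EuclideanSpace ℝ (Fin 3) → ℝ)
    (hG₁ : Integrable G₁) (hG₂ : Integrable G₂)
    (hdom : ∃ ε > 0, ∀ α : ℝ, |α - α₀| < ε →
      ∀ s : EuclideanSpace ℝ (Fin 3),
        ‖ρ' s α‖ ≤ G₁ s ∧
        ∀ τ ∈ Set.Icc (-1:ℝ) 1, ‖s‖ * ‖A' (r + (τ/2) • s) α‖ * ‖ρ s α‖ ≤ G₂ s) :
    HasDerivAt
      (fun α : ℝ => (((2 * Real.pi * ℏ) ^ 3)⁻¹ : ℝ) *
        ∫ s, Complex.exp (wsPhase ℏ q P r A s α) * ρ s α)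
      ((((2 * Real.pi * ℏ) ^ 3)⁻¹ : ℝ) *
          (∫ s, Complex.exp (wsPhase ℏ q P r A s α₀) * ρ' s α₀)
        + (q / (2 * Complex.I * ℏ)) * (((2 * Real.pi * ℏ) ^ 3)⁻¹ : ℝ) *
          ∫ s, Complex.exp (wsPhase ℏ q P r A s α₀) *
            (⟪s, ∫ τ in (-1:ℝ)..1, A' (r + (τ/2) • s) α₀⟫ : ℝ) * ρ s α₀)
      α₀ := by
  obtain ⟨ε, hε, hdom⟩ := hdom
  have hAc1 : ∀ α ∈ Set.Ioo a b, Continuous fun x => A x α := fun α hα =>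
    hAc.comp_continuous (Continuous.prodMk_left α) fun x => ⟨Set.mem_univ x, hα⟩
  have hA'c1 : ∀ α ∈ Set.Ioo a b, Continuous fun x => A' x α := fun α hα =>
    hA'c.comp_continuous (Continuous.prodMk_left α) fun x => ⟨Set.mem_univ x, hα⟩
  have hexp : ∀ α ∈ Set.Ioo a b,
      AEStronglyMeasurable (fun s => Complex.exp (wsPhase ℏ q P r A s α)) := fun α hα => by
    have := continuous_intervalIntegral_segment (hAc1 α hα) r (-1) 1
    unfold wsPhase
    exact Continuous.aestronglyMeasurable (by fun_prop)
  set J : EuclideanSpace ℝ (Fin 3) → ℝ → ℝ := fun s α => ⟪s, ∫ τ in (-1:ℝ)..1, A' (r + (τ/2) • s) α⟫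
  have hJc : Continuous fun s => J s α₀ :=
    continuous_id.inner (continuous_intervalIntegral_segment (hA'c1 α₀ hα₀) r (-1) 1)
  have hnhds : Set.Ioo a b ∈ 𝓝 α₀ := isOpen_Ioo.mem_nhds hα₀
  have hρ'm : AEStronglyMeasurable fun s => ρ' s α₀ :=
    aestronglyMeasurable_of_hasDerivAt_param
      (by filter_upwards [hnhds] with α hα using (hρi α hα).aestronglyMeasurable)
      fun s => hρ' s α₀ hα₀
  have hJ : ∀ α, |α - α₀| < ε → ∀ s, ‖(J s α : ℂ) * ρ s α‖ ≤ 2 * G₂ s := fun α hα s => by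
    have hb := (hdom α hα s).2
    rw [norm_mul, Complex.norm_real]
    have h1 : ‖‖s‖ * ‖ρ s α‖ * ‖∫ τ in (-1:ℝ)..1, A' (r + (τ/2) • s) α‖‖ ≤
        G₂ s * |1 - (-1)| := by
      have := intervalIntegral.norm_integral_le_of_norm_le_const (a := -1) (b := 1) (C := G₂ s)
        (f := fun τ : ℝ => (‖s‖ * ‖ρ s α‖) • A' (r + (τ/2) • s) α) fun τ hτ => by
          rw [Set.uIoc_of_le (by norm_num)] at hτ
          rw [norm_smul, norm_mul, norm_norm, norm_norm]
          linarith [hb τ (Set.Ioc_subset_Icc_self hτ)]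
      rw [intervalIntegral.integral_smul, norm_smul] at this
      simpa only [norm_mul, norm_norm] using this
    rw [Real.norm_of_nonneg (by positivity)] at h1
    norm_num at h1
    calc ‖J s α‖ * ‖ρ s α‖
        ≤ (‖s‖ * ‖∫ τ in (-1:ℝ)..1, A' (r + (τ/2) • s) α‖) * ‖ρ s α‖ := by
          gcongr
          exact norm_inner_le_norm _ _
      _ ≤ 2 * G₂ s := by linarith
  have hs : Set.Ioo a b ∩ Metric.ball α₀ ε ∈ 𝓝 α₀ :=
    inter_mem hnhds (Metric.ball_mem_nhds α₀ hε)
  have hball : ∀ α ∈ Metric.ball α₀ ε, |α - α₀| < ε := fun α hα => by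
    rwa [Metric.mem_ball, Real.dist_eq] at hα
  have hα₀ε : |α₀ - α₀| < ε := by simpa using hε
  have hi1 : Integrable fun s => Complex.exp (wsPhase ℏ q P r A s α₀) * ρ' s α₀ :=
    hG₁.mono' ((hexp α₀ hα₀).mul hρ'm) (ae_of_all _ fun s => by
      rw [norm_mul, norm_exp_wsPhase, one_mul]
      exact (hdom α₀ hα₀ε s).1)
  have hi2 : Integrable fun s =>
      Complex.exp (wsPhase ℏ q P r A s α₀) * (J s α₀ : ℂ) * ρ s α₀ :=
    (hG₂.const_mul 2).mono'
      (((hexp α₀ hα₀).mul (Complex.continuous_ofReal.comp hJc).aestronglyMeasurable).mul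
        (hρi α₀ hα₀).aestronglyMeasurable) (ae_of_all _ fun s => by
      rw [mul_assoc, norm_mul, norm_exp_wsPhase, one_mul]
      exact hJ α₀ hα₀ε s)
  have key := (hasDerivAt_integral_of_dominated_loc_of_deriv_le (μ := volume)
    (F := fun α s => Complex.exp (wsPhase ℏ q P r A s α) * ρ s α)
    (F' := fun α s => Complex.exp (wsPhase ℏ q P r A s α) * ρ' s α +
      (q / (2 * Complex.I * ℏ)) *
        (Complex.exp (wsPhase ℏ q P r A s α) * (J s α : ℂ) * ρ s α))
    (bound := fun s => G₁ s + ‖(q / (2 * Complex.I * ℏ) : ℂ)‖ * (2 * G₂ s)) hs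
    (by filter_upwards [hnhds] with α hα using
          (hexp α hα).mul (hρi α hα).aestronglyMeasurable)
    ((hρi α₀ hα₀).mono ((hexp α₀ hα₀).mul (hρi α₀ hα₀).aestronglyMeasurable)
      (ae_of_all _ fun s => by rw [norm_mul, norm_exp_wsPhase, one_mul]))
    (hi1.add (hi2.const_mul _)).aestronglyMeasurable
    (ae_of_all _ fun s α hα => by
      refine (norm_add_le _ _).trans ?_
      rw [mul_assoc (Complex.exp _), norm_mul, norm_mul _ (Complex.exp _ * _),
        norm_mul (Complex.exp _), norm_exp_wsPhase, one_mul, one_mul]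
      gcongr
      · exact (hdom α (hball α hα.2) s).1
      · exact hJ α (hball α hα.2) s)
    (hG₁.add ((hG₂.const_mul 2).const_mul _))
    (ae_of_all _ fun s α hα => by
      refine ((hasDerivAt_wsPhase isOpen_Ioo hAc1 hA' hA'c ℏ q P r s hα.1).cexp.mul
        (hρ' s α hα.1)).congr_deriv ?_
      ring)).2
  refine (key.const_mul ((((2 * Real.pi * ℏ) ^ 3)⁻¹ : ℝ) : ℂ)).congr_deriv ?_
  rw [integral_add hi1 (hi2.const_mul _), integral_const_mul]
  ring
end

section
/- Let ℏ>0, q∈ℝ, C:=(2πℏ)^{−3}, fix P,r∈ℝ³. Let ρ̃:ℝ³→ℂ be a Schwartz function and let A:ℝ³→ℝ³ be continuously differentiable with A and its Jacobian matrix bounded on ℝ³. Write Φ(s) := (1/(iℏ)) s·(P + (q/2)∫_{−1}^{1} A(r+τs/2) dτ). Then for every j∈{1,2,3}: C∫_{ℝ³} exp(Φ(s)) (−iℏ ∂ρ̃/∂s_j)(s) ds = C∫_{ℝ³} exp(Φ(s)) [ P_j + (q/2)∫_{−1}^{1} A_j(r+τs/2) dτ + (q/4)∫_{−1}^{1} τ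 ( Σ_{k=1}^{3} s_k ∂A_k/∂r_j (r+τs/2) ) dτ ] ρ̃(s) ds. -/
open MeasureTheory RealInnerProductSpace Complex SchwartzMap

section PhaseDerivatives

variable {V W : Type*} [NormedAddCommGroup V] [NormedAddCommGroup W] [NormedSpace ℝ W]

theorem norm_integral_neg_one_one_le {f : ℝ → W} {M : ℝ}
    (hf : ∀ τ, |τ| ≤ 1 → ‖f τ‖ ≤ M) : ‖∫ τ in (-1:ℝ)..1, f τ‖ ≤ 2 * M := by
  have h := intervalIntegral.norm_integral_le_of_norm_le_const
    (a := -1) (b := 1) (f := f) (C := M) fun τ hτ => by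
      rw [Set.uIoc_of_le (by norm_num)] at hτ
      exact hf τ (abs_le.2 ⟨hτ.1.le, hτ.2⟩)
  rw [show |(1:ℝ) - -1| = 2 by norm_num] at h
  linarith

/-- Differentiation of segment averages under the integral sign. -/
theorem hasFDerivAt_integral_segment [NormedSpace ℝ V] {A : V → W} (hA : ContDiff ℝ 1 A)
    {M : ℝ} (hM : ∀ x, ‖fderiv ℝ A x‖ ≤ M) (r s : V) :
    HasFDerivAt (fun s => ∫ τ in (-1:ℝ)..1, A (r + (τ/2) • s))
      (∫ τ in (-1:ℝ)..1, (τ/2) • fderiv ℝ A (r + (τ/2) • s)) s := by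
  have hA' : Continuous (fderiv ℝ A) := hA.continuous_fderiv one_ne_zero
  have hAc : Continuous A := hA.continuous
  have hM0 : 0 ≤ M := (norm_nonneg _).trans (hM 0)
  refine intervalIntegral.hasFDerivAt_integral_of_dominated_of_fderiv_le
    (F' := fun s τ => (τ/2) • fderiv ℝ A (r + (τ/2) • s)) (bound := fun _ => M)
    Filter.univ_mem (.of_forall fun x => ?_) ?_ ?_ ?_ ?_ ?_
  · exact Continuous.aestronglyMeasurable (by fun_prop)
  · exact Continuous.intervalIntegrable (by fun_prop) _ _
  · exact Continuous.aestronglyMeasurable (by fun_prop)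
  · refine .of_forall fun τ hτ x _ => ?_
    rw [Set.uIoc_of_le (by norm_num)] at hτ
    rw [norm_smul, Real.norm_eq_abs]
    have : |τ/2| ≤ 1 := abs_le.2 ⟨by linarith [hτ.1], by linarith [hτ.2]⟩
    calc |τ/2| * ‖fderiv ℝ A (r + (τ/2) • x)‖ ≤ 1 * M := by gcongr; exact hM _
      _ = M := one_mul M
  · exact continuous_const.intervalIntegrable _ _
  · refine .of_forall fun τ _ x _ => ?_
    have h := ((hA.differentiable one_ne_zero) (r + (τ/2) • x)).hasFDerivAt.comp x
      (((hasFDerivAt_id x).const_smul (τ/2)).const_add r)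
    refine h.congr_fderiv ?_
    ext v
    simp

variable [InnerProductSpace ℝ V]

/-- The phase `s · (P + (q/2) ∫ A(r + τ s/2) dτ)` is differentiable. -/
theorem differentiable_phase {A : V → V} (hA : ContDiff ℝ 1 A)
    {M : ℝ} (hM : ∀ x, ‖fderiv ℝ A x‖ ≤ M) (q : ℝ) (P r : V) :
    Differentiable ℝ
      fun s : V => ⟪s, P + (q/2) • ∫ τ in (-1:ℝ)..1, A (r + (τ/2) • s)⟫ := fun s =>
  differentiableAt_id.inner ℝ
    (((hasFDerivAt_integral_segment hA hM r s).differentiableAt.const_smul (q/2)).const_add P)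

theorem fderiv_phase_apply [CompleteSpace V] {A : V → V} (hA : ContDiff ℝ 1 A)
    {M : ℝ} (hM : ∀ x, ‖fderiv ℝ A x‖ ≤ M) (q : ℝ) (P r s v : V) :
    fderiv ℝ (fun s : V => ⟪s, P + (q/2) • ∫ τ in (-1:ℝ)..1, A (r + (τ/2) • s)⟫) s v
      = ⟪v, P⟫ + (q/2) * (∫ τ in (-1:ℝ)..1, ⟪v, A (r + (τ/2) • s)⟫)
        + (q/4) * ∫ τ in (-1:ℝ)..1, τ * ⟪s, fderiv ℝ A (r + (τ/2) • s) v⟫ := by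
  have hA' : Continuous (fderiv ℝ A) := hA.continuous_fderiv one_ne_zero
  have hAc : Continuous A := hA.continuous
  have hK := ((hasFDerivAt_integral_segment hA hM r s).const_smul (q/2)).const_add P
  have h1 : ∫ τ in (-1:ℝ)..1, ⟪v, A (r + (τ/2) • s)⟫
      = ⟪v, ∫ τ in (-1:ℝ)..1, A (r + (τ/2) • s)⟫ :=
    (innerSL ℝ v).intervalIntegral_comp_comm
      (Continuous.intervalIntegrable (by fun_prop) _ _)
  have h2 : ∫ τ in (-1:ℝ)..1, τ * ⟪s, fderiv ℝ A (r + (τ/2) • s) v⟫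
      = 2 * ⟪s, (∫ τ in (-1:ℝ)..1, (τ/2) • fderiv ℝ A (r + (τ/2) • s)) v⟫ := by
    rw [ContinuousLinearMap.intervalIntegral_apply
      (Continuous.intervalIntegrable (by fun_prop) _ _)]
    have h := (innerSL ℝ s).intervalIntegral_comp_comm (μ := volume) (a := -1) (b := 1)
      (f := fun τ => ((τ/2) • fderiv ℝ A (r + (τ/2) • s)) v)
      (Continuous.intervalIntegrable (by fun_prop) _ _)
    simp only [innerSL_apply_apply] at h
    rw [← h, ← intervalIntegral.integral_const_mul]
    congr 1 with τ
    simp only [smul_apply, inner_smul_right]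
    ring
  have h3 := (hasFDerivAt_id (𝕜 := ℝ) s).inner ℝ hK
  have h4 := congrArg (fun L : V →L[ℝ] ℝ => L v) h3.fderiv
  simp only [id] at h4
  refine h4.trans ?_
  rw [h1, h2]
  simp [fderivInnerCLM_apply, inner_add_right, inner_smul_right]
  ring

theorem abs_fderiv_phase_le [CompleteSpace V] {A : V → V} (hA : ContDiff ℝ 1 A)
    {M : ℝ} (hM : ∀ x, ‖A x‖ ≤ M ∧ ‖fderiv ℝ A x‖ ≤ M) (q : ℝ) (P r s v : V) :
    |fderiv ℝ (fun s : V => ⟪s, P + (q/2) • ∫ τ in (-1:ℝ)..1, A (r + (τ/2) • s)⟫) s v|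
      ≤ ‖v‖ * (‖P‖ + |q/2| * (2 * M)) + |q/4| * (2 * M) * ‖v‖ * ‖s‖ := by
  have hM0 : 0 ≤ M := (norm_nonneg _).trans (hM 0).1
  have h1 : ‖∫ τ in (-1:ℝ)..1, ⟪v, A (r + (τ/2) • s)⟫‖ ≤ 2 * (‖v‖ * M) :=
    norm_integral_neg_one_one_le fun τ _ => (norm_inner_le_norm _ _).trans (by
      gcongr; exact (hM _).1)
  have h2 : ‖∫ τ in (-1:ℝ)..1, τ * ⟪s, fderiv ℝ A (r + (τ/2) • s) v⟫‖
      ≤ 2 * (1 * (‖s‖ * (M * ‖v‖))) :=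
    norm_integral_neg_one_one_le fun τ hτ => by
      rw [norm_mul]
      gcongr
      · exact hτ
      · refine (norm_inner_le_norm _ _).trans ?_
        gcongr
        exact ContinuousLinearMap.le_of_opNorm_le _ (hM _).2 v
  rw [fderiv_phase_apply hA fun x => (hM x).2, ← Real.norm_eq_abs]
  refine norm_add₃_le.trans ?_
  rw [norm_mul, norm_mul, Real.norm_eq_abs (q/2), Real.norm_eq_abs (q/4)]
  calc _ ≤ ‖v‖ * ‖P‖ + |q/2| * (2 * (‖v‖ * M)) + |q/4| * (2 * (1 * (‖s‖ * (M * ‖v‖)))) := by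
        gcongr
        exact norm_inner_le_norm _ _
    _ = _ := by ring

end PhaseDerivatives

/-- Integration by parts against an oscillating exponential whose phase has a directional
derivative of at most linear growth. -/
theorem integral_exp_phase_mul_fderiv {V : Type*} [NormedAddCommGroup V] [NormedSpace ℝ V]
    [FiniteDimensional ℝ V] [MeasurableSpace V] [BorelSpace V]
    {μ : Measure V} [μ.IsAddHaarMeasure] {ℏ : ℝ} (hℏ : ℏ ≠ 0) {φ : V → ℝ}
    (hφ : Differentiable ℝ φ) {v : V} {a b : ℝ} (hab : ∀ s, |fderiv ℝ φ s v| ≤ a + b * ‖s‖)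
    (ρ : 𝓢(V, ℂ)) :
    ∫ s, Complex.exp ((1 / (Complex.I * ℏ)) * (φ s : ℂ)) *
        (-(Complex.I * ℏ) * fderiv ℝ ρ s v) ∂μ
      = ∫ s, Complex.exp ((1 / (Complex.I * ℏ)) * (φ s : ℂ)) * (fderiv ℝ φ s v : ℂ) * ρ s ∂μ := by
  set f : V → ℂ := fun s => Complex.exp ((1 / (Complex.I * ℏ)) * (φ s : ℂ)) with hf
  have hℏ' : (ℏ : ℂ) ≠ 0 := by exact_mod_cast hℏ
  have hf1 : ∀ s, ‖f s‖ = 1 := fun s => by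
    have h : (1 / (Complex.I * ℏ)) * (φ s : ℂ) = ((-φ s / ℏ : ℝ) : ℂ) * Complex.I := by
      rw [one_div, mul_inv, Complex.inv_I]
      push_cast
      ring
    rw [hf]
    simp only [h, Complex.norm_exp_ofReal_mul_I]
  have hderiv : ∀ s, HasFDerivAt f
      (f s • (1 / (Complex.I * ℏ)) • Complex.ofRealCLM.comp (fderiv ℝ φ s)) s := fun s =>
    ((Complex.ofRealCLM.hasFDerivAt.comp s (hφ s).hasFDerivAt).const_mul
      (1 / (Complex.I * ℏ))).cexp
  have hfd : ∀ s, fderiv ℝ f s v = f s * ((1 / (Complex.I * ℏ)) * (fderiv ℝ φ s v : ℂ)) :=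
    fun s => by rw [(hderiv s).fderiv]; simp
  have hdiff : Differentiable ℝ f := fun s => (hderiv s).differentiableAt
  have hfmul : ∀ g : 𝓢(V, ℂ), Integrable (fun s => f s * g s) μ := fun g =>
    (g.integrable (μ := μ)).bdd_mul hdiff.continuous.aestronglyMeasurable
      (.of_forall fun s => (hf1 s).le)
  have hf'g : Integrable (fun s => fderiv ℝ f s v * ρ s) μ := by
    have hbound : Integrable (fun s => |ℏ|⁻¹ * (a * ‖ρ s‖ + b * (‖s‖ ^ 1 * ‖ρ s‖))) μ :=
      (((ρ.integrable (μ := μ)).norm.const_mul a).add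
        ((ρ.integrable_pow_mul μ 1).const_mul b)).const_mul _
    refine hbound.mono' ((measurable_fderiv_apply_const ℝ f v).aestronglyMeasurable.mul
      ρ.continuous.aestronglyMeasurable) (.of_forall fun s => ?_)
    rw [hfd]
    simp only [one_div, norm_mul, norm_inv, hf1, Complex.norm_I, Complex.norm_real,
      Real.norm_eq_abs, one_mul]
    calc |ℏ|⁻¹ * |fderiv ℝ φ s v| * ‖ρ s‖ ≤ |ℏ|⁻¹ * (a + b * ‖s‖) * ‖ρ s‖ := by
          gcongr; exact hab s
      _ = _ := by ring
  have key := integral_mul_fderiv_eq_neg_fderiv_mul_of_integrable hf'g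
    (hfmul (LineDeriv.lineDerivOp v ρ)) (hfmul ρ) (fun s _ => hdiff s)
    (fun s _ => ρ.differentiableAt)
  calc ∫ s, f s * (-(Complex.I * ℏ) * fderiv ℝ ρ s v) ∂μ
      = -(Complex.I * ℏ) * ∫ s, f s * fderiv ℝ ρ s v ∂μ := by
        rw [← integral_const_mul]
        congr 1 with s
        ring
    _ = ∫ s, (Complex.I * ℏ) * (fderiv ℝ f s v * ρ s) ∂μ := by
        rw [key, integral_const_mul]
        ring
    _ = _ := by
        congr 1 with s
        rw [hfd]
        have hc : Complex.I * ℏ ≠ 0 := mul_ne_zero Complex.I_ne_zero hℏ'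
        change _ = f s * (fderiv ℝ φ s v : ℂ) * ρ s
        linear_combination f s * (fderiv ℝ φ s v : ℂ) * ρ s * mul_one_div_cancel hc

/-- Integration by parts in `s`: the Weyl–Stratonovich transform of
`−iℏ ∂ρ̃/∂s_j` equals the transform of
`[P_j + (q/2)∫ A_j(r+τs/2)dτ + (q/4)∫ τ (Σ_k s_k ∂A_k/∂r_j)(r+τs/2) dτ] ρ̃(s)`
(integral form of `𝒯(p f_w) = [P + qA·sinc + (qℏ/2)∇_r(∇_P·A)·sinc'] F_s`). -/
theorem weyl_stratonovich_of_momentum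
    (ℏ q : ℝ) (hℏ : 0 < ℏ) (P r : EuclideanSpace ℝ (Fin 3))
    (ρ : SchwartzMap (EuclideanSpace ℝ (Fin 3)) ℂ)
    (A : EuclideanSpace ℝ (Fin 3) → EuclideanSpace ℝ (Fin 3))
    (hA : ContDiff ℝ 1 A)
    (hAbdd : ∃ M : ℝ, ∀ x, ‖A x‖ ≤ M ∧ ‖fderiv ℝ A x‖ ≤ M) :
    ∀ j : Fin 3,
      (((2 * Real.pi * ℏ) ^ 3)⁻¹ : ℝ) *
        (∫ s : EuclideanSpace ℝ (Fin 3),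
          Complex.exp ((1 / (Complex.I * ℏ)) *
            (⟪s, P + (q/2) • ∫ τ in (-1:ℝ)..1, A (r + (τ/2) • s)⟫ : ℝ)) *
          (-(Complex.I * ℏ) * fderiv ℝ (⇑ρ) s (EuclideanSpace.single j 1)))
      = (((2 * Real.pi * ℏ) ^ 3)⁻¹ : ℝ) *
        ∫ s : EuclideanSpace ℝ (Fin 3),
          Complex.exp ((1 / (Complex.I * ℏ)) *
            (⟪s, P + (q/2) • ∫ τ in (-1:ℝ)..1, A (r + (τ/2) • s)⟫ : ℝ)) *
          (((P j : ℝ) : ℂ)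
            + ((q/2) * ∫ τ in (-1:ℝ)..1, A (r + (τ/2) • s) j : ℝ)
            + ((q/4) * ∫ τ in (-1:ℝ)..1,
                τ * ⟪s, fderiv ℝ A (r + (τ/2) • s) (EuclideanSpace.single j 1)⟫ : ℝ)) *
          ρ s := by
  intro j
  obtain ⟨M, hM⟩ := hAbdd
  have hM' := fun x => (hM x).2
  rw [integral_exp_phase_mul_fderiv hℏ.ne' (differentiable_phase hA hM' q P r)
    (abs_fderiv_phase_le hA hM q P r · (EuclideanSpace.single j 1)) ρ]
  congr 2 with s
  rw [fderiv_phase_apply hA hM']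
  simp [EuclideanSpace.inner_single_left]
end

section
/- Let ℏ>0, q∈ℝ, C:=(2πℏ)^{−3}, and fix P∈ℝ³ and a spacetime point X=(r,t)∈ℝ³×ℝ. Let ψ:ℝ³×ℝ→ℂ, A:ℝ³×ℝ→ℝ³ and φ:ℝ³×ℝ→ℝ be continuous. For y=(s,τ)∈ℝ³×ℝ define H(s,τ) := exp( (q/(2iℏ)) ∫_{−1}^{1} [ s·A(X+γy/2) + τ·φ(X+γy/2) ] dγ ) · ψ(X+y/2)·conj(ψ(X−y/2)), and define the four-dimensional gauge-invariant Wigner function ρ̂_w(P,ε) := (C/(2πℏ)) ∫_{ℝ}∫_{ℝ³} exp((1/(iℏ))(s·P + τε)) H(s,τ) ds dτ for ε∈ℝ. Assume (s,τ)↦H(s,τ) is integrable on ℝ³×ℝ, that for each s the map τ↦H(s,τ) is continuous and integrable with integrable Fourier transform ε↦∫exp((1/(iℏ))τε)H(s,τ)dτ, and that (s,ε)↦|∫exp((1/(iℏ))τε)H(s,τ)dτ| is integrable on ℝ³×ℝ. Then ∫_{ℝ} ρ̂_w(P,ε) dε = C ∫_{ℝ³} exp( (1/(iℏ)) s·( P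 + (q/2)∫_{−1}^{1} A(r+γs/2, t) dγ ) ) ψ(r+s/2,t)·conj(ψ(r−s/2,t)) ds, i.e. integrating the four-dimensional gauge-invariant Wigner function over the energy variable yields the Stratonovich function F_s(P,r,t). -/
open MeasureTheory RealInnerProductSpace Complex

open scoped FourierTransform in
/-- Fourier inversion at the origin, in the physicists' normalization with Planck constant `ℏ`. -/
lemma integral_integral_cexp_mul_eq {ℏ : ℝ} (hℏ : 0 < ℏ) {f : ℝ → ℂ} (hc : Continuous f)
    (hf : Integrable f)
    (hf' : Integrable
      (fun ε : ℝ => ∫ τ : ℝ, Complex.exp ((1 / (Complex.I * ℏ)) * (τ * ε)) * f τ)) :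
    ∫ ε : ℝ, ∫ τ : ℝ, Complex.exp ((1 / (Complex.I * ℏ)) * (τ * ε)) * f τ
      = (2 * Real.pi * ℏ : ℝ) * f 0 := by
  have hb : 0 < 2 * Real.pi * ℏ := by positivity
  have key : ∀ w : ℝ, 𝓕 f w = ∫ τ : ℝ,
      Complex.exp ((1 / (Complex.I * ℏ)) * (τ * ((2 * Real.pi * ℏ * w : ℝ) : ℂ))) * f τ := by
    intro w
    rw [Real.fourier_real_eq_integral_exp_smul]
    refine integral_congr_ae (.of_forall fun τ => ?_)
    simp only [smul_eq_mul]
    congr 2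
    have : (ℏ : ℂ) ≠ 0 := by exact_mod_cast hℏ.ne'
    push_cast
    field_simp
    ring_nf
    simp only [Complex.I_sq]
    ring
  have hF : Integrable (𝓕 f) := by
    rw [funext key]
    exact hf'.comp_mul_left' hb.ne'
  have inv : ∫ w, 𝓕 f w = f 0 := by
    have h := congrFun (hc.fourierInv_fourier_eq hf hF) 0
    rw [Real.fourierInv_eq'] at h
    simpa using h
  have sub := Measure.integral_comp_mul_left
    (fun ε : ℝ => ∫ τ : ℝ, Complex.exp ((1 / (Complex.I * ℏ)) * (τ * ε)) * f τ) (2 * Real.pi * ℏ)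
  rw [← inv, funext key, sub, abs_of_pos (inv_pos.mpr hb), Complex.real_smul, ← mul_assoc,
    ← Complex.ofReal_mul, mul_inv_cancel₀ hb.ne', Complex.ofReal_one, one_mul]

/-- The exponential of a real number divided by `iℏ` has modulus one. -/
lemma norm_cexp_one_div_I_mul (ℏ x : ℝ) :
    ‖Complex.exp ((1 / (Complex.I * ℏ)) * (x : ℂ))‖ = 1 := by
  have : (1 / (Complex.I * ℏ)) * (x : ℂ) = ((-(x / ℏ) : ℝ) : ℂ) * Complex.I := by
    push_cast
    rw [one_div, mul_inv, Complex.inv_I]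
    ring
  rw [this, Complex.norm_exp_ofReal_mul_I]

/-- The energy integral of the four-dimensional Fourier transform of `H` collapses it onto
the slice `τ = 0`. -/
lemma integral_energy_eq_slice {E : Type*} [NormedAddCommGroup E] [InnerProductSpace ℝ E]
    [FiniteDimensional ℝ E] [MeasurableSpace E] [BorelSpace E] {ℏ : ℝ} (hℏ : 0 < ℏ) (P : E)
    {H : E → ℝ → ℂ} (hH : Continuous (Function.uncurry H))
    (hint : Integrable (fun p : E × ℝ => H p.1 p.2))
    (hslice : ∀ s, Integrable (H s))
    (hhat : ∀ s, Integrable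
      (fun ε : ℝ => ∫ τ : ℝ, Complex.exp ((1 / (Complex.I * ℏ)) * (τ * ε)) * H s τ))
    (hprod : Integrable (fun p : E × ℝ =>
      ‖∫ τ : ℝ, Complex.exp ((1 / (Complex.I * ℏ)) * (τ * p.2)) * H p.1 τ‖)) :
    ∫ ε : ℝ, ∫ τ : ℝ, ∫ s : E,
        Complex.exp ((1 / (Complex.I * ℏ)) * ((⟪s, P⟫ : ℝ) + τ * ε)) * H s τ
      = (2 * Real.pi * ℏ : ℝ) *
        ∫ s : E, Complex.exp ((1 / (Complex.I * ℏ)) * (⟪s, P⟫ : ℝ)) * H s 0 := by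
  have swap : ∀ ε : ℝ, ∫ τ : ℝ, ∫ s : E,
        Complex.exp ((1 / (Complex.I * ℏ)) * ((⟪s, P⟫ : ℝ) + τ * ε)) * H s τ
      = ∫ s : E, Complex.exp ((1 / (Complex.I * ℏ)) * (⟪s, P⟫ : ℝ)) *
        ∫ τ : ℝ, Complex.exp ((1 / (Complex.I * ℏ)) * (τ * ε)) * H s τ := by
    intro ε
    rw [← integral_integral_swap]
    · refine integral_congr_ae (.of_forall fun s => ?_)
      simp only
      rw [← integral_const_mul]
      simp only [mul_add, Complex.exp_add, mul_assoc]
    · refine hint.bdd_mul (c := 1) (Continuous.aestronglyMeasurable (by fun_prop))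
        (.of_forall fun p => le_of_eq ?_)
      exact_mod_cast norm_cexp_one_div_I_mul ℏ (⟪p.1, P⟫ + p.2 * ε)
  have hG : AEStronglyMeasurable (fun p : E × ℝ =>
      ∫ τ : ℝ, Complex.exp ((1 / (Complex.I * ℏ)) * (τ * p.2)) * H p.1 τ) := by
    have hc : Continuous (fun x : (E × ℝ) × ℝ =>
        Complex.exp ((1 / (Complex.I * ℏ)) * (x.2 * x.1.2)) * H x.1.1 x.2) := by
      have : Continuous (fun x : (E × ℝ) × ℝ => H x.1.1 x.2) :=
        hH.comp (continuous_fst.fst.prodMk continuous_snd)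
      fun_prop
    exact hc.stronglyMeasurable.integral_prod_right'.aestronglyMeasurable
  simp_rw [swap]
  rw [← integral_integral_swap, ← integral_const_mul]
  · refine integral_congr_ae (.of_forall fun s => ?_)
    simp only
    rw [integral_const_mul, integral_integral_cexp_mul_eq hℏ (f := H s)
      (hH.comp (Continuous.prodMk_right s)) (hslice s) (hhat s)]
    ring
  · refine ((integrable_norm_iff hG).mp hprod).bdd_mul (c := 1)
      (Continuous.aestronglyMeasurable (by fun_prop))
      (.of_forall fun p => (norm_cexp_one_div_I_mul ℏ _).le)

/-- Integrating the four-dimensional gauge-invariant Wigner function of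
Levanda–Fleurov over the energy variable yields the Stratonovich function: `F_s` is a
marginal distribution of `ρ̂_w`. -/
theorem energy_marginal_of_4d_wigner
    (ℏ q : ℝ) (hℏ : 0 < ℏ)
    (P r : EuclideanSpace ℝ (Fin 3)) (t : ℝ)
    (ψ : EuclideanSpace ℝ (Fin 3) → ℝ → ℂ)
    (hψ : Continuous (Function.uncurry ψ))
    (A : EuclideanSpace ℝ (Fin 3) → ℝ → EuclideanSpace ℝ (Fin 3))
    (hA : Continuous (Function.uncurry A))
    (φ : EuclideanSpace ℝ (Fin 3) → ℝ → ℝ)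
    (hφ : Continuous (Function.uncurry φ))
    (H : EuclideanSpace ℝ (Fin 3) → ℝ → ℂ)
    (hH : ∀ (s : EuclideanSpace ℝ (Fin 3)) (τ : ℝ), H s τ =
      Complex.exp ((q / (2 * Complex.I * ℏ)) *
          ((∫ γ in (-1:ℝ)..1,
              (⟪s, A (r + (γ/2) • s) (t + γ*τ/2)⟫ + τ * φ (r + (γ/2) • s) (t + γ*τ/2))) : ℝ)) *
        (ψ (r + (1/2:ℝ) • s) (t + τ/2) * starRingEnd ℂ (ψ (r - (1/2:ℝ) • s) (t - τ/2))))
    (hHint : Integrable (fun p : EuclideanSpace ℝ (Fin 3) × ℝ => H p.1 p.2))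
    (hHcont : ∀ s : EuclideanSpace ℝ (Fin 3), Continuous (H s))
    (hHsliceInt : ∀ s : EuclideanSpace ℝ (Fin 3), Integrable (H s))
    (hHhatInt : ∀ s : EuclideanSpace ℝ (Fin 3),
      Integrable (fun ε : ℝ => ∫ τ : ℝ, Complex.exp ((1 / (Complex.I * ℏ)) * (τ * ε)) * H s τ))
    (hHhatProdInt : Integrable (fun p : EuclideanSpace ℝ (Fin 3) × ℝ =>
      ‖∫ τ : ℝ, Complex.exp ((1 / (Complex.I * ℏ)) * (τ * p.2)) * H p.1 τ‖)) :
    (∫ ε : ℝ,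
        ((((2 * Real.pi * ℏ) ^ 3)⁻¹ / (2 * Real.pi * ℏ) : ℝ) : ℂ) *
          ∫ τ : ℝ, ∫ s : EuclideanSpace ℝ (Fin 3),
            Complex.exp ((1 / (Complex.I * ℏ)) * ((⟪s, P⟫ : ℝ) + τ * ε)) * H s τ)
      = (((2 * Real.pi * ℏ) ^ 3)⁻¹ : ℝ) *
          ∫ s : EuclideanSpace ℝ (Fin 3),
            Complex.exp ((1 / (Complex.I * ℏ)) *
              (⟪s, P + (q/2) • ∫ γ in (-1:ℝ)..1, A (r + (γ/2) • s) t⟫ : ℝ)) *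
            (ψ (r + (1/2:ℝ) • s) t * starRingEnd ℂ (ψ (r - (1/2:ℝ) • s) t)) := by
  have hcont : Continuous (Function.uncurry H) := by
    have hA' : Continuous (fun x : (EuclideanSpace ℝ (Fin 3) × ℝ) × ℝ =>
        A (r + (x.2/2) • x.1.1) (t + x.2*x.1.2/2)) :=
      hA.comp (by fun_prop : Continuous (fun x : (EuclideanSpace ℝ (Fin 3) × ℝ) × ℝ =>
        (r + (x.2/2) • x.1.1, t + x.2*x.1.2/2)))
    have hφ' : Continuous (fun x : (EuclideanSpace ℝ (Fin 3) × ℝ) × ℝ =>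
        φ (r + (x.2/2) • x.1.1) (t + x.2*x.1.2/2)) :=
      hφ.comp (by fun_prop : Continuous (fun x : (EuclideanSpace ℝ (Fin 3) × ℝ) × ℝ =>
        (r + (x.2/2) • x.1.1, t + x.2*x.1.2/2)))
    have hphase : Continuous (fun p : EuclideanSpace ℝ (Fin 3) × ℝ =>
        ∫ γ in (-1:ℝ)..1, (⟪p.1, A (r + (γ/2) • p.1) (t + γ*p.2/2)⟫ +
          p.2 * φ (r + (γ/2) • p.1) (t + γ*p.2/2))) := by
      refine intervalIntegral.continuous_parametric_intervalIntegral_of_continuous' ?_ _ _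
      exact (continuous_fst.fst.inner hA').add (continuous_fst.snd.mul hφ')
    have hψ₁ : Continuous (fun p : EuclideanSpace ℝ (Fin 3) × ℝ =>
        ψ (r + (1/2:ℝ) • p.1) (t + p.2/2)) :=
      hψ.comp (by fun_prop : Continuous (fun p : EuclideanSpace ℝ (Fin 3) × ℝ =>
        (r + (1/2:ℝ) • p.1, t + p.2/2)))
    have hψ₂ : Continuous (fun p : EuclideanSpace ℝ (Fin 3) × ℝ =>
        ψ (r - (1/2:ℝ) • p.1) (t - p.2/2)) :=
      hψ.comp (by fun_prop : Continuous (fun p : EuclideanSpace ℝ (Fin 3) × ℝ =>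
        (r - (1/2:ℝ) • p.1, t - p.2/2)))
    have hHeq : Function.uncurry H = fun p => _ := funext fun p => hH p.1 p.2
    rw [hHeq]
    exact (Complex.continuous_exp.comp
      (continuous_const.mul (Complex.continuous_ofReal.comp hphase))).mul
        (hψ₁.mul (Complex.continuous_conj.comp hψ₂))
  rw [integral_const_mul, integral_energy_eq_slice hℏ P hcont hHint hHsliceInt hHhatInt
    hHhatProdInt, ← mul_assoc, ← Complex.ofReal_mul, div_mul_cancel₀ _ (by positivity)]
  congr 1
  refine integral_congr_ae (.of_forall fun s => ?_)
  have hAs : IntervalIntegrable (fun γ : ℝ => A (r + (γ/2) • s) t) volume (-1) 1 :=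
    (hA.comp (by fun_prop : Continuous (fun γ : ℝ => (r + (γ/2) • s, t)))).intervalIntegrable _ _
  have hinner : ∫ γ in (-1:ℝ)..1, ⟪s, A (r + (γ/2) • s) t⟫
      = ⟪s, ∫ γ in (-1:ℝ)..1, A (r + (γ/2) • s) t⟫ :=
    (innerSL ℝ s).intervalIntegral_comp_comm hAs
  simp only [hH, mul_zero, zero_div, add_zero, sub_zero, zero_mul, hinner]
  rw [← mul_assoc, ← Complex.exp_add, inner_add_right, inner_smul_right]
  congr 2
  push_cast
  ring
end
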